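/- Let A be a simple unital C*-algebra which admits a tracial state, such that every tracial state on A is faithful, and which has strict comparison of positive elements. Let a ∈ A be a nonzero positive element such that 0 is a non-isolated point of the spectrum σ(a), and let b ∈ A be a positive element such that d_τ(a) ≤ d_τ(b) for every tracial state τ on A. Then a ≾ b. -/

import Mathlib

open Filter Topology

/-- Cuntz subequivalence: `a ≾ b` iff there is a sequence `xₙ` with `xₙ * b * xₙ* → a`
(equivalently, `‖xₙ * b * xₙ* - a‖ → 0` in a normed setting). -/
def CuntzLE {M : Type*} [Mul M] [Star M] [TopologicalSpace M] (a b : M) : Prop :=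
  ∃ x : ℕ → M, Tendsto (fun n => x n * b * star (x n)) atTop (𝓝 a)

/-- Cuntz equivalence: `a ∼ b` iff `a ≾ b` and `b ≾ a`. -/
def CuntzEquiv {M : Type*} [Mul M] [Star M] [TopologicalSpace M] (a b : M) : Prop :=
  CuntzLE a b ∧ CuntzLE b a

open scoped ComplexOrder in
/-- A tracial state on a unital C*-algebra: a positive linear functional taking the
value `1` at `1` and satisfying the trace identity. -/
def IsTracialState {A : Type*} [CStarAlgebra A] [PartialOrder A] (τ : A →ₗ[ℂ] ℂ) : Prop :=
  (∀ a : A, 0 ≤ a → 0 ≤ τ a) ∧ τ 1 = 1 ∧ ∀ x y : A, τ (x * y) = τ (y * x)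

/-- `dTr τ a = lim_n τ(a^{1/n})`, the dimension function associated to a trace `τ`,
evaluated at a positive element `a`. -/
noncomputable def dTr {A : Type*} [CStarAlgebra A] (τ : A → ℂ) (a : A) : ℝ :=
  limUnder atTop fun n : ℕ => (τ (cfc (fun t : ℝ => t ^ ((n : ℝ)⁻¹)) a)).re

/-- A C*-algebra has strict comparison of positive elements (with respect to tracial states)
if `d_τ(a) < d_τ(b)` for all tracial states `τ` implies `a ≾ b`, for nonzero positive `a, b`. -/
def StrictComparison (A : Type*) [CStarAlgebra A] [PartialOrder A] : Prop :=
  ∀ a b : A, 0 ≤ a → 0 ≤ b → a ≠ 0 → b ≠ 0 →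
    (∀ τ : A →ₗ[ℂ] ℂ, IsTracialState τ → dTr τ a < dTr τ b) → CuntzLE a b

section TraceMonotonicity

variable {A : Type*} [CStarAlgebra A] [PartialOrder A] [StarOrderedRing A]

/-- The real part of a tracial state is monotone. -/
lemma IsTracialState.re_mono {τ : A →ₗ[ℂ] ℂ} (hτ : IsTracialState τ) {x y : A} (hxy : x ≤ y) :
    (τ x).re ≤ (τ y).re := by
  have h := (Complex.le_def.1 (hτ.1 _ (sub_nonneg.2 hxy))).1
  simpa using h

/-- The real part of a tracial state is monotone along the functional calculus. -/
lemma IsTracialState.re_cfc_mono {τ : A →ₗ[ℂ] ℂ} (hτ : IsTracialState τ) {a : A} (ha : 0 ≤ a)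
    {f g : ℝ → ℝ} (hf : ContinuousOn f (Set.Ici 0)) (hg : ContinuousOn g (Set.Ici 0))
    (h : ∀ t, 0 ≤ t → f t ≤ g t) :
    (τ (cfc f a)).re ≤ (τ (cfc g a)).re := by
  have hs : spectrum ℝ a ⊆ Set.Ici 0 := fun t ht => spectrum_nonneg_of_nonneg ha ht
  exact hτ.re_mono (cfc_mono (fun t ht => h t (hs ht)) (hf.mono hs) (hg.mono hs))

/-- For a positive element `a`, the sequence `τ(a^{1/n})` converges to `dTr τ a`. -/
lemma IsTracialState.tendsto_dTr {τ : A →ₗ[ℂ] ℂ} (hτ : IsTracialState τ) {a : A} (ha : 0 ≤ a) :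
    Tendsto (fun n : ℕ => (τ (cfc (fun t : ℝ => t ^ ((n : ℝ)⁻¹)) a)).re) atTop
      (𝓝 (dTr τ a)) := by
  refine tendsto_nhds_limUnder ?_
  have hpos (n : ℕ) : (0 : ℝ) ≤ ((n + 1 : ℕ) : ℝ)⁻¹ := by positivity
  have hcmin (n : ℕ) : Continuous fun t : ℝ => min t 1 ^ ((n + 1 : ℕ) : ℝ)⁻¹ :=
    (continuous_id.min continuous_const).rpow_const fun _ => Or.inr (hpos n)
  have hcmax (n : ℕ) : Continuous fun t : ℝ => max t 1 ^ ((n + 1 : ℕ) : ℝ)⁻¹ :=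
    (continuous_id.max continuous_const).rpow_const fun _ => Or.inr (hpos n)
  have hinv {m n : ℕ} (hmn : m ≤ n) : ((n + 1 : ℕ) : ℝ)⁻¹ ≤ ((m + 1 : ℕ) : ℝ)⁻¹ := by
    gcongr
  have hone (f : ℝ → ℝ) (hf : Continuous f) (h : ∀ t, 0 ≤ t → f t ≤ 1) :
      (τ (cfc f a)).re ≤ 1 := by
    have := hτ.re_cfc_mono ha hf.continuousOn (continuousOn_const (c := (1 : ℝ))) h
    rwa [cfc_const_one ℝ a, hτ.2.1, Complex.one_re] at this
  have hzero (f : ℝ → ℝ) (hf : Continuous f) (h : ∀ t, 0 ≤ t → 0 ≤ f t) :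
      0 ≤ (τ (cfc f a)).re := by
    have := hτ.re_cfc_mono ha (continuousOn_const (c := (0 : ℝ))) hf.continuousOn h
    rwa [cfc_const_zero ℝ a, map_zero, Complex.zero_re] at this
  have hmin : Monotone fun n : ℕ =>
      (τ (cfc (fun t : ℝ => min t 1 ^ ((n + 1 : ℕ) : ℝ)⁻¹) a)).re := by
    intro m n hmn
    refine hτ.re_cfc_mono ha (hcmin m).continuousOn (hcmin n).continuousOn fun t ht => ?_
    exact Real.rpow_le_rpow_of_exponent_ge_of_imp (le_min ht zero_le_one) (min_le_right _ _)
      (hinv hmn) fun _ h => absurd h (by positivity)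
  have hmax : Antitone fun n : ℕ =>
      (τ (cfc (fun t : ℝ => max t 1 ^ ((n + 1 : ℕ) : ℝ)⁻¹) a)).re := by
    intro m n hmn
    refine hτ.re_cfc_mono ha (hcmax n).continuousOn (hcmax m).continuousOn fun t ht => ?_
    exact Real.rpow_le_rpow_of_exponent_le (le_max_right _ _) (hinv hmn)
  have hlim₁ := tendsto_atTop_ciSup hmin ⟨1, by
    rintro _ ⟨n, rfl⟩
    exact hone _ (hcmin n) fun t ht =>
      Real.rpow_le_one (le_min ht zero_le_one) (min_le_right _ _) (hpos n)⟩
  have hlim₂ := tendsto_atTop_ciInf hmax ⟨0, by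
    rintro _ ⟨n, rfl⟩
    exact hzero _ (hcmax n) fun t ht => by positivity⟩
  refine ⟨_, (tendsto_add_atTop_iff_nat 1).1
    (((hlim₁.add hlim₂).sub_const 1).congr fun n => ?_)⟩
  have hsplit : cfc (fun t : ℝ => t ^ ((n + 1 : ℕ) : ℝ)⁻¹) a + 1 =
      cfc (fun t : ℝ => min t 1 ^ ((n + 1 : ℕ) : ℝ)⁻¹) a +
        cfc (fun t : ℝ => max t 1 ^ ((n + 1 : ℕ) : ℝ)⁻¹) a := by
    rw [← cfc_const_one ℝ a, ← cfc_add .., ← cfc_add ..]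
    refine cfc_congr fun t _ => ?_
    rcases le_total t 1 with h | h
    · simp [h]
    · simp [h, add_comm]
  have := congrArg (fun x => (τ x).re) hsplit
  simp only [map_add, hτ.2.1, Complex.add_re, Complex.one_re] at this
  linarith

/-- Cutting a positive element `a` down by `ε` strictly decreases its dimension if the spectrum
of `a` meets `(0, ε)` and the trace is faithful. -/
lemma IsTracialState.dTr_cutdown_lt {τ : A →ₗ[ℂ] ℂ} (hτ : IsTracialState τ)
    (hfaithful : ∀ x : A, 0 ≤ x → x ≠ 0 → 0 < (τ x).re) {a : A} (ha : 0 ≤ a) {ε s : ℝ}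
    (hs : s ∈ spectrum ℝ a) (hs0 : 0 < s) (hsε : s < ε) :
    dTr τ (cfc (fun t : ℝ => max (t - ε) 0) a) < dTr τ a := by
  have hgc : Continuous fun t : ℝ => max (t - ε) 0 := by fun_prop
  have hhc : Continuous fun t : ℝ => max (min (min t 1) (ε - t)) 0 := by fun_prop
  have hpos : 0 < (τ (cfc (fun t : ℝ => max (min (min t 1) (ε - t)) 0) a)).re := by
    refine hfaithful _ (cfc_nonneg fun t _ => le_max_right _ _) fun h0 => ?_
    have h : max (min (min s 1) (ε - s)) 0 ∈
        spectrum ℝ (cfc (fun t : ℝ => max (min (min t 1) (ε - t)) 0) a) := by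
      rw [cfc_map_spectrum ..]
      exact ⟨s, hs, rfl⟩
    rw [h0] at h
    have : Nontrivial A := by
      by_contra hn
      rw [not_nontrivial_iff_subsingleton] at hn
      simp [spectrum.of_subsingleton] at hs
    rw [spectrum.zero_eq, Set.mem_singleton_iff] at h
    have : 0 < min (min s 1) (ε - s) := lt_min (lt_min hs0 one_pos) (sub_pos.2 hsε)
    exact absurd h (this.trans_le (le_max_left _ _)).ne'
  have hg : 0 ≤ cfc (fun t : ℝ => max (t - ε) 0) a := cfc_nonneg fun t _ => le_max_right _ _
  refine (lt_add_of_pos_right _ hpos).trans_le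
    (le_of_tendsto_of_tendsto ((hτ.tendsto_dTr hg).add_const _) (hτ.tendsto_dTr ha) ?_)
  filter_upwards [eventually_ge_atTop 1] with n hn
  have hn0 : (0 : ℝ) < (n : ℝ)⁻¹ := by positivity
  have hn1 : (n : ℝ)⁻¹ ≤ 1 := inv_le_one_of_one_le₀ (by exact_mod_cast hn)
  have hpc : Continuous fun t : ℝ => t ^ (n : ℝ)⁻¹ := Real.continuous_rpow_const hn0.le
  rw [← cfc_comp' (fun t : ℝ => t ^ (n : ℝ)⁻¹) (fun t : ℝ => max (t - ε) 0) a
      hpc.continuousOn hgc.continuousOn, ← Complex.add_re, ← map_add,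
    ← cfc_add a (fun t : ℝ => max (t - ε) 0 ^ (n : ℝ)⁻¹) _ (hpc.comp hgc).continuousOn
      hhc.continuousOn]
  refine hτ.re_cfc_mono ha ((hpc.comp hgc).add hhc).continuousOn hpc.continuousOn fun t ht => ?_
  rcases le_total ε t with h | h
  · rw [max_eq_right ((min_le_right _ _).trans (sub_nonpos.2 h)), add_zero]
    exact Real.rpow_le_rpow (le_max_right _ _)
      (max_le (by linarith) ht) hn0.le
  · rw [max_eq_right (sub_nonpos.2 h), Real.zero_rpow hn0.ne', zero_add]
    refine max_le ((min_le_left _ _).trans ?_) (Real.rpow_nonneg ht _)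
    rcases le_total t 1 with h1 | h1
    · rw [min_eq_left h1]
      simpa using Real.rpow_le_rpow_of_exponent_ge_of_imp ht h1 hn1 fun _ h => absurd h one_ne_zero
    · rw [min_eq_right h1]
      exact Real.one_le_rpow h1 hn0.le

/-- Cutting a positive element down by `ε` moves it by at most `ε` in norm. -/
lemma norm_cutdown_sub_le {a : A} (ha : 0 ≤ a) {ε : ℝ} (hε : 0 ≤ ε) :
    ‖cfc (fun t : ℝ => max (t - ε) 0) a - a‖ ≤ ε := by
  have hgc : Continuous fun t : ℝ => max (t - ε) 0 := by fun_prop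
  nth_rewrite 2 [← cfc_id ℝ a]
  rw [← cfc_sub _ _ a hgc.continuousOn continuousOn_id]
  refine norm_cfc_le hε fun t ht => ?_
  have ht0 : 0 ≤ t := spectrum_nonneg_of_nonneg ha ht
  rw [Real.norm_eq_abs, abs_le, id]
  rcases le_total ε t with h | h
  · rw [max_eq_left (sub_nonneg.2 h)]
    constructor <;> linarith
  · rw [max_eq_right (sub_nonpos.2 h)]
    constructor <;> linarith

end TraceMonotonicity

/-- If elements arbitrarily close to `a` are Cuntz below `b`, then so is `a`. -/
lemma CuntzLE.of_forall_norm_sub_le {A : Type*} [CStarAlgebra A] {a b : A}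
    (h : ∀ ε : ℝ, 0 < ε → ∃ c : A, ‖c - a‖ ≤ ε ∧ CuntzLE c b) : CuntzLE a b := by
  have key (ε : ℝ) (hε : 0 < ε) : ∃ x : A, ‖x * b * star x - a‖ ≤ ε := by
    obtain ⟨c, hc, x, hx⟩ := h (ε / 2) (half_pos hε)
    obtain ⟨n, hn⟩ := (Metric.tendsto_nhds.1 hx (ε / 2) (half_pos hε)).exists
    rw [dist_eq_norm] at hn
    exact ⟨x n, (norm_sub_le_norm_sub_add_norm_sub _ c _).trans (by linarith)⟩
  choose x hx using fun n : ℕ => key (1 / ((n : ℝ) + 1)) Nat.one_div_pos_of_nat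
  exact ⟨x, tendsto_iff_norm_sub_tendsto_zero.2
    (squeeze_zero (fun _ => norm_nonneg _) hx tendsto_one_div_add_atTop_nhds_zero_nat)⟩

open scoped ComplexOrder in
/-- In a simple unital C*-algebra with tracial states, all faithful, and with strict comparison,
if `a` is a nonzero positive element with `0` a non-isolated point of its spectrum and `b` is
positive with `d_τ(a) ≤ d_τ(b)` for every tracial state `τ`, then `a ≾ b`. -/
theorem cuntzLE_of_dTr_le {A : Type*} [CStarAlgebra A] [PartialOrder A] [StarOrderedRing A]
    (hsimple : ∀ I : TwoSidedIdeal A, IsClosed (I : Set A) → I = ⊥ ∨ I = ⊤)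
    (hexists : ∃ τ : A →ₗ[ℂ] ℂ, IsTracialState τ)
    (hfaithful : ∀ τ : A →ₗ[ℂ] ℂ, IsTracialState τ → ∀ x : A, 0 ≤ x → x ≠ 0 → 0 < τ x)
    (hcomp : StrictComparison A)
    (a b : A) (ha : 0 ≤ a) (ha0 : a ≠ 0)
    (hacc : (0 : ℝ) ∈ closure (spectrum ℝ a \ {0}))
    (hb : 0 ≤ b)
    (hd : ∀ τ : A →ₗ[ℂ] ℂ, IsTracialState τ → dTr τ a ≤ dTr τ b) :
    CuntzLE a b := by
  have hcut {ε : ℝ} (hε : 0 < ε) {τ : A →ₗ[ℂ] ℂ} (hτ : IsTracialState τ) :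
      dTr τ (cfc (fun t : ℝ => max (t - ε) 0) a) < dTr τ a := by
    obtain ⟨s, ⟨hs, hs0⟩, hsε⟩ := Metric.mem_closure_iff.1 hacc ε hε
    have hs_pos : 0 < s := lt_of_le_of_ne (spectrum_nonneg_of_nonneg ha hs) (Ne.symm hs0)
    rw [dist_comm, Real.dist_0_eq_abs, abs_of_pos hs_pos] at hsε
    exact hτ.dTr_cutdown_lt (fun x hx hx0 => (Complex.lt_def.1 (hfaithful τ hτ x hx hx0)).1)
      ha hs hs_pos hsε
  have hg (ε : ℝ) : 0 ≤ cfc (fun t : ℝ => max (t - ε) 0) a :=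
    cfc_nonneg fun t _ => le_max_right _ _
  have hb0 : b ≠ 0 := by
    rintro rfl
    obtain ⟨τ, hτ⟩ := hexists
    have h0 : dTr τ (0 : A) ≤ dTr τ (cfc (fun t : ℝ => max (t - 1) 0) a) := by
      refine le_of_tendsto_of_tendsto (hτ.tendsto_dTr le_rfl) (hτ.tendsto_dTr (hg 1)) ?_
      filter_upwards [eventually_ge_atTop 1] with n hn
      have hn0 : (n : ℝ)⁻¹ ≠ 0 := by positivity
      rw [cfc_apply_zero, Real.zero_rpow hn0, map_zero]
      exact hτ.re_mono (cfc_nonneg fun t ht =>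
        Real.rpow_nonneg (spectrum_nonneg_of_nonneg (hg 1) ht) _)
    exact absurd (hd τ hτ) (h0.trans_lt (hcut one_pos hτ)).not_ge
  refine CuntzLE.of_forall_norm_sub_le fun ε hε => ⟨_, norm_cutdown_sub_le ha hε.le, ?_⟩
  by_cases hz : cfc (fun t : ℝ => max (t - ε) 0) a = 0
  · exact ⟨0, by simp [hz]⟩
  · exact hcomp _ _ (hg ε) hb hz hb0 fun τ hτ => (hcut hε hτ).trans_le (hd τ hτ)
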